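/- Let A ∈ S^d(ℂ^n) be a symmetric d-tensor. Then ‖A‖_{*,ℂ} = min{ Σ_{j=1}^r ‖x_j‖^d : A = Σ_{j=1}^r x_j^{⊗d}, x_j ∈ ℂ^n, r ∈ ℕ }, where the minimum is over all finite symmetric rank-one decompositions of A and is attained. -/

import Mathlib

open scoped BigOperators

noncomputable section

/-- The outer (tensor) product of vectors `x k ∈ ℂ^{n k}`, giving the rank-one tensor
with entries `∏ k, (x k) (i k)`. -/
def rankOne {ι : Type} [Fintype ι] {n : ι → ℕ}
    (x : (k : ι) → EuclideanSpace ℂ (Fin (n k))) : ((k : ι) → Fin (n k)) → ℂ :=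
  fun i => ∏ k, x k (i k)

/-- The nuclear norm of a tensor. -/
def nucNorm {ι : Type} [Fintype ι] [DecidableEq ι] {n : ι → ℕ}
    (A : ((k : ι) → Fin (n k)) → ℂ) : ℝ :=
  sInf { s : ℝ | ∃ (r : ℕ) (x : Fin r → (k : ι) → EuclideanSpace ℂ (Fin (n k))),
    A = (∑ i, rankOne (x i)) ∧ s = ∑ i, ∏ k, ‖x i k‖ }

open Function in
/-- Polarization identity in two slots of a symmetric multilinear form. -/
theorem MultilinearMap.polarization_of_symmetric {ι E : Type*} [Fintype ι] [DecidableEq ι]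
    [AddCommGroup E] [Module ℂ E] (f : MultilinearMap ℂ (fun _ : ι => E) ℂ)
    (hf : ∀ (σ : Equiv.Perm ι) (x : ι → E), f (x ∘ σ) = f x)
    (z : ι → E) {i j : ι} (hij : i ≠ j) :
    4 * f z = f (update (update z i (z i + z j)) j (z i + z j)) -
      f (update (update z i (z i - z j)) j (z i - z j)) := by
  have hcomm : ∀ p q, update (update z i p) j q = update (update z j q) i p :=
    fun p q => update_comm hij p q z
  have hsymm : ∀ p q, f (update (update z i p) j q) = f (update (update z i q) j p) := by
    intro p q
    rw [← hf (Equiv.swap i j) (update (update z i p) j q)]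
    congr 1
    ext k
    rcases eq_or_ne k i with rfl | hki
    · simp [hij]
    · rcases eq_or_ne k j with rfl | hkj
      · simp [hij]
      · simp [hki, hkj, Equiv.swap_apply_of_ne_of_ne]
  have hself : f z = f (update (update z i (z i)) j (z j)) := by simp
  rw [f.map_update_add, f.map_update_sub, hcomm _ (z i), hcomm _ (z j), hcomm _ (z i),
    hcomm _ (z j)]
  simp only [f.map_update_add, f.map_update_sub]
  simp only [← hcomm]
  rw [hsymm (z j) (z i), ← hself]
  ring

open Function in
/-- Banach's theorem: a symmetric complex multilinear form attains its norm on the diagonal. -/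
theorem MultilinearMap.exists_diagonal_norm_le {ι E : Type*} [Fintype ι] [DecidableEq ι]
    [Nonempty ι] [NormedAddCommGroup E] [InnerProductSpace ℂ E] [FiniteDimensional ℂ E]
    (f : MultilinearMap ℂ (fun _ : ι => E) ℂ) (hcont : Continuous f)
    (hf : ∀ (σ : Equiv.Perm ι) (x : ι → E), f (x ∘ σ) = f x) :
    ∃ y : E, ‖y‖ ≤ 1 ∧ ∀ x : ι → E, ‖x‖ ≤ 1 → ‖f x‖ ≤ ‖f fun _ => y‖ := by
  have : ProperSpace E := FiniteDimensional.proper ℂ E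
  obtain ⟨x, hx1, hxmax⟩ := (isCompact_closedBall (0 : ι → E) 1).exists_isMaxOn
    ⟨0, by simp⟩ (hcont.norm.continuousOn)
  rw [mem_closedBall_zero_iff] at hx1
  have hmax : ∀ z : ι → E, ‖z‖ ≤ 1 → ‖f z‖ ≤ ‖f x‖ := fun z hz =>
    hxmax (mem_closedBall_zero_iff.2 hz)
  set L := ‖f x‖ with hL
  rcases (norm_nonneg (f x)).eq_or_lt with h0 | hpos
  · exact ⟨0, by simp, fun z hz => (hmax z hz).trans (by rw [hL, ← h0]; positivity)⟩
  have hx0 : ∀ k, x k ≠ 0 := fun k hk => by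
    rw [f.map_coord_zero k hk] at hpos; simp at hpos
  obtain ⟨φ, hφ⟩ := Module.exists_dual_forall_apply_ne_zero (K := ℂ) x hx0
  have hφc : Continuous φ := φ.continuous_of_finiteDimensional
  choose c hc1 hc using fun k => RCLike.exists_norm_eq_mul_self (φ (x k))
  obtain ⟨k₀, hk₀⟩ := Finite.exists_min fun k => ‖φ (x k)‖
  set δ := ‖φ (x k₀)‖ with hδ
  have hδpos : 0 < δ := norm_pos_iff.2 (hφ k₀)
  let C : Set (ι → E) := Metric.closedBall 0 1 ∩ ({z | ‖f z‖ = L} ∩ {z | ∀ k, δ ≤ (φ (z k)).re})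
  have hCc : IsCompact C := by
    refine (isCompact_closedBall _ _).inter_right
      ((isClosed_eq hcont.norm continuous_const).inter ?_)
    simp only [Set.ofPred_forall]
    exact isClosed_iInter fun k => isClosed_le continuous_const
      (Complex.continuous_re.comp (hφc.comp (continuous_apply k)))
  have hCne : C.Nonempty := by
    refine ⟨fun k => c k • x k, ?_, ?_, fun k => ?_⟩
    · rw [mem_closedBall_zero_iff, pi_norm_le_iff_of_nonneg zero_le_one]
      intro k
      rw [norm_smul, hc1, one_mul]
      exact (norm_le_pi_norm x k).trans hx1
    · simp [f.map_smul_univ, hc1, hL]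
    · have := hc k
      simp only [map_smul, smul_eq_mul, ← this]
      simpa using hk₀ k
  obtain ⟨z, ⟨hz1, hzL, hzδ⟩, hzmax⟩ := hCc.exists_isMaxOn (f := fun z => ∑ k, (φ (z k)).re) hCne
    (by fun_prop)
  rw [mem_closedBall_zero_iff] at hz1
  have hzk : ∀ k, ‖z k‖ ≤ 1 := fun k => (norm_le_pi_norm z k).trans hz1
  have hupd : ∀ (i j : ι) (p : E), ‖p‖ ≤ 1 → ‖update (update z i p) j p‖ ≤ 1 := by
    intro i j p hp
    rw [pi_norm_le_iff_of_nonneg zero_le_one]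
    intro k
    simp only [update_apply]
    split_ifs <;> simp [hp, hzk]
  have heq : ∀ i j, z i = z j := by
    intro i j
    by_contra hne
    have hij : i ≠ j := fun h => hne (by rw [h])
    have hscale : ∀ p : E, f (update (update z i p) j p) =
        (‖p‖ : ℂ) ^ 2 * f (update (update z i ((‖p‖ : ℂ)⁻¹ • p)) j ((‖p‖ : ℂ)⁻¹ • p)) := by
      intro p
      rcases eq_or_ne p 0 with rfl | hp
      · simp [f.map_coord_zero j]
      have hp' : (‖p‖ : ℂ) ≠ 0 := by simpa using hp
      rw [f.map_update_smul, update_comm hij ((‖p‖ : ℂ)⁻¹ • p) p z, f.map_update_smul,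
        update_comm hij.symm]
      simp only [smul_eq_mul]
      field_simp
    have hunit : ∀ p : E, ‖(‖p‖ : ℂ)⁻¹ • p‖ ≤ 1 := by
      intro p
      rw [norm_smul, norm_inv, Complex.norm_real, norm_norm]
      exact inv_mul_le_one
    have hpol := congrArg norm (f.polarization_of_symmetric hf z hij)
    rw [hscale (z i + z j), hscale (z i - z j)] at hpol
    set w := z i + z j with hw
    set u := (‖w‖ : ℂ)⁻¹ • w with hu
    set v := (‖z i - z j‖ : ℂ)⁻¹ • (z i - z j)
    have hpar := parallelogram_law_with_norm ℂ (z i) (z j)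
    rw [← hw] at hpar
    have hφw : (φ w).re = (φ (z i)).re + (φ (z j)).re := by simp [hw]
    have hi := hzδ i
    have hj := hzδ j
    have hwpos : 0 < ‖w‖ := by
      rw [norm_pos_iff]
      intro h
      rw [h] at hφw
      simp at hφw
      linarith
    have hsub : 0 < ‖z i - z j‖ := norm_pos_iff.2 (sub_ne_zero.2 hne)
    have hi2 : ‖z i‖ ^ 2 ≤ 1 := pow_le_one₀ (norm_nonneg _) (hzk i)
    have hj2 : ‖z j‖ ^ 2 ≤ 1 := pow_le_one₀ (norm_nonneg _) (hzk j)
    have hw2 : ‖w‖ < 2 := by nlinarith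
    have hvL := hmax _ (hupd i j v (hunit _))
    have huL := hmax _ (hupd i j u (hunit _))
    have hzL' : ‖f z‖ = L := hzL
    have h4 : 4 * L ≤ ‖w‖ ^ 2 * ‖f (update (update z i u) j u)‖ + ‖z i - z j‖ ^ 2 * L := by
      calc 4 * L = ‖(4 : ℂ) * f z‖ := by simp [hzL']
        _ ≤ _ := hpol.le.trans (norm_sub_le _ _)
        _ ≤ _ := by
          simp only [norm_mul, norm_pow, Complex.norm_real, norm_norm]
          gcongr
    have huL' : ‖f (update (update z i u) j u)‖ = L := by
      refine le_antisymm huL (le_of_mul_le_mul_left ?_ (pow_pos hwpos 2))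
      nlinarith
    have hφu : (φ u).re = ((φ (z i)).re + (φ (z j)).re) / ‖w‖ := by
      rw [hu, map_smul, smul_eq_mul, ← Complex.ofReal_inv, Complex.re_ofReal_mul, hφw]
      ring
    have hgt : (φ (z i)).re + (φ (z j)).re < 2 * (φ u).re := by
      rw [hφu, ← mul_div_assoc, lt_div_iff₀ hwpos]
      nlinarith
    have hmem : update (update z i u) j u ∈ C := by
      refine ⟨mem_closedBall_zero_iff.2 (hupd i j u (hunit _)), huL', fun k => ?_⟩
      simp only [update_apply]
      split_ifs
      · linarith
      · linarith
      · exact hzδ k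
    have hle := hzmax hmem
    simp only [Set.mem_ofPred_eq] at hle
    rw [← sub_nonpos, ← Finset.sum_sub_distrib, Finset.sum_eq_add i j hij] at hle
    · simp [hij] at hle
      linarith
    · rintro k - ⟨hki, hkj⟩
      simp [hki, hkj]
    · simp
    · simp
  obtain ⟨i⟩ := ‹Nonempty ι›
  refine ⟨z i, hzk i, fun y hy => ?_⟩
  have : (fun _ => z i) = z := funext fun k => heq i k
  rw [this]
  exact (hmax y hy).trans_eq (Eq.symm hzL)

/-- The convex hull of a compact set in a finite-dimensional real space is compact. -/
theorem IsCompact.convexHull_of_finiteDimensional {V : Type*} [NormedAddCommGroup V]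
    [NormedSpace ℝ V] [FiniteDimensional ℝ V] {S : Set V} (hS : IsCompact S) :
    IsCompact (convexHull ℝ S) := by
  let F (m : ℕ) (p : (Fin m → ℝ) × (Fin m → V)) : V := ∑ i, p.1 i • p.2 i
  have key : convexHull ℝ S = ⋃ m ∈ Finset.range (Module.finrank ℝ V + 2),
      F m '' (stdSimplex ℝ (Fin m) ×ˢ Set.univ.pi fun _ => S) := by
    ext x
    simp only [Set.mem_iUnion, Set.mem_image, exists_prop]
    constructor
    · intro hx
      obtain ⟨ι, _, z, w, hz, hind, hw, hw1, rfl⟩ := eq_pos_convex_span_of_mem_convexHull hx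
      let e := Fintype.equivFin ι
      refine ⟨Fintype.card ι, ?_, (w ∘ e.symm, z ∘ e.symm), ⟨⟨fun i => (hw _).le, ?_⟩,
        fun i _ => hz ⟨_, rfl⟩⟩, ?_⟩
      · have := hind.card_le_finrank_succ
        have := Submodule.finrank_le (vectorSpan ℝ (Set.range z))
        simp only [Finset.mem_range]
        omega
      · simpa [e.symm.sum_comp w] using hw1
      · exact e.symm.sum_comp fun i => w i • z i
    · rintro ⟨m, -, ⟨w, z⟩, ⟨⟨hw, hw1⟩, hz⟩, rfl⟩
      exact (convex_convexHull ℝ S).sum_mem (fun i _ => hw i) hw1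
        fun i _ => subset_convexHull ℝ S (hz i trivial)
  rw [key]
  refine (Finset.range _).isCompact_biUnion fun m _ => ?_
  exact ((isCompact_stdSimplex ℝ (Fin m)).prod (isCompact_univ_pi fun _ => hS)).image
    (by fun_prop)

open Pointwise in
/-- Elements of nonnegative dilates of a nonempty convex set add up to an element of a dilate. -/
theorem Convex.sum_mem_sum_smul {ι V : Type*} [AddCommGroup V] [Module ℝ V] {K : Set V}
    (hK : Convex ℝ K) (hne : K.Nonempty) (t : Finset ι) {p : ι → ℝ} {v : ι → V}
    (hp : ∀ i ∈ t, 0 ≤ p i) (hv : ∀ i ∈ t, v i ∈ p i • K) :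
    ∑ i ∈ t, v i ∈ (∑ i ∈ t, p i) • K := by
  classical
  induction t using Finset.induction_on with
  | empty => simp [Set.zero_smul_set hne]
  | insert a t ha ih =>
    simp only [Finset.mem_insert, forall_eq_or_imp] at hp hv
    rw [Finset.sum_insert ha, Finset.sum_insert ha,
      hK.add_smul hp.1 (Finset.sum_nonneg hp.2)]
    exact Set.add_mem_add hv.1 (ih hp.2 hv.2)

/-- The outer product as a multilinear map. -/
def rankOneMultilinear (d n : ℕ) :
    MultilinearMap ℂ (fun _ : Fin d => EuclideanSpace ℂ (Fin n)) ((Fin d → Fin n) → ℂ) :=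
  MultilinearMap.pi fun i => (MultilinearMap.mkPiAlgebra ℂ (Fin d) ℂ).compLinearMap
    fun k => (EuclideanSpace.proj (i k) : EuclideanSpace ℂ (Fin n) →L[ℂ] ℂ).toLinearMap

theorem rankOneMultilinear_apply {d n : ℕ} (x : Fin d → EuclideanSpace ℂ (Fin n)) :
    rankOneMultilinear d n x = rankOne x := by
  ext i
  simp [rankOneMultilinear, rankOne]

theorem continuous_rankOne (d n : ℕ) :
    Continuous fun x : Fin d → EuclideanSpace ℂ (Fin n) => rankOne x := by
  unfold rankOne
  fun_prop

theorem rankOne_smul {d n : ℕ} (c : Fin d → ℂ) (x : Fin d → EuclideanSpace ℂ (Fin n)) :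
    rankOne (fun k => c k • x k) = (∏ k, c k) • rankOne x := by
  simp only [← rankOneMultilinear_apply, MultilinearMap.map_smul_univ]

theorem rankOne_comp_perm {d n : ℕ} (x : Fin d → EuclideanSpace ℂ (Fin n))
    (σ : Equiv.Perm (Fin d)) (i : Fin d → Fin n) :
    rankOne (x ∘ σ) (i ∘ σ) = rankOne x i :=
  Equiv.prod_comp σ fun k => x k (i k)

/-- The `d`-th tensor powers of the vectors in the closed unit ball. -/
def powerBall (d n : ℕ) : Set ((Fin d → Fin n) → ℂ) :=
  (fun y : EuclideanSpace ℂ (Fin n) => rankOne fun _ : Fin d => y) '' Metric.closedBall 0 1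

theorem isCompact_convexHull_powerBall (d n : ℕ) : IsCompact (convexHull ℝ (powerBall d n)) :=
  ((isCompact_closedBall _ _).image ((continuous_rankOne d n).comp
    (continuous_pi fun _ => continuous_id))).convexHull_of_finiteDimensional

theorem zero_mem_convexHull_powerBall {d n : ℕ} (hd : 0 < d) :
    0 ∈ convexHull ℝ (powerBall d n) := by
  refine subset_convexHull ℝ _ ⟨0, by simp, ?_⟩
  ext i
  simp [rankOne, hd.ne']

/-- Average of a rank-one tensor over all permutations of its factors. -/
def symRankOne {d n : ℕ} (x : Fin d → EuclideanSpace ℂ (Fin n)) : (Fin d → Fin n) → ℂ :=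
  ((d.factorial : ℝ)⁻¹) • ∑ σ : Equiv.Perm (Fin d), rankOne (x ∘ σ)

theorem symRankOne_mem_convexHull_of_norm_le_one {d n : ℕ} (hd : 0 < d)
    (x : Fin d → EuclideanSpace ℂ (Fin n)) (hx : ‖x‖ ≤ 1) :
    symRankOne x ∈ convexHull ℝ (powerBall d n) := by
  have : Nonempty (Fin d) := ⟨⟨0, hd⟩⟩
  by_contra hnot
  obtain ⟨g, u, hgu, hux⟩ := RCLike.geometric_hahn_banach_closed_point (𝕜 := ℂ)
    (convex_convexHull ℝ _) (isCompact_convexHull_powerBall d n).isClosed hnot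
  let f : MultilinearMap ℂ (fun _ : Fin d => EuclideanSpace ℂ (Fin n)) ℂ :=
    ∑ σ : Equiv.Perm (Fin d),
      (g.toLinearMap.compMultilinearMap (rankOneMultilinear d n)).domDomCongr σ
  have hf : ∀ z, f z = ∑ σ : Equiv.Perm (Fin d), g (rankOne (z ∘ σ)) := by
    intro z
    simp [f, rankOneMultilinear_apply, Function.comp_def]
  have hcont : Continuous f := by
    rw [funext hf]
    exact continuous_finsetSum _ fun σ _ => g.continuous.comp ((continuous_rankOne d n).comp
      (continuous_pi fun k => continuous_apply (σ k)))
  have hfsymm : ∀ (σ : Equiv.Perm (Fin d)) z, f (z ∘ σ) = f z := by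
    intro σ z
    rw [hf, hf]
    exact Equiv.sum_comp (Equiv.mulLeft σ) fun τ : Equiv.Perm (Fin d) => g (rankOne (z ∘ τ))
  obtain ⟨y, hy1, hy⟩ := f.exists_diagonal_norm_le hcont hfsymm
  have hfact : (0 : ℝ) < d.factorial := by exact_mod_cast d.factorial_pos
  obtain ⟨c, hc1, hc⟩ := RCLike.exists_norm_eq_mul_self (f fun _ => y)
  obtain ⟨ω, hω⟩ := IsAlgClosed.exists_pow_nat_eq c hd
  have hω1 : ‖ω‖ = 1 := by
    rw [← pow_eq_one_iff_of_nonneg (norm_nonneg _) hd.ne', ← norm_pow, hω, hc1]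
  have hdiag : ∀ v : EuclideanSpace ℂ (Fin n),
      f (fun _ => v) = d.factorial * g (rankOne fun _ : Fin d => v) := by
    intro v
    rw [hf]
    simp [Function.comp_def, Fintype.card_perm]
  have hlt : ‖f fun _ => y‖ < d.factorial * u := by
    have h1 := hgu _ (subset_convexHull ℝ _
      ⟨ω • y, by simpa [norm_smul, hω1] using hy1, rfl⟩)
    have h2 : ((‖f fun _ => y‖ : ℝ) : ℂ) = d.factorial * g (rankOne fun _ : Fin d => ω • y) := by
      rw [← hdiag, f.map_smul_univ (fun _ => ω) (fun _ => y)]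
      simpa [hω] using hc
    have h3 := congrArg Complex.re h2
    rw [← Complex.ofReal_natCast, Complex.re_ofReal_mul, Complex.ofReal_re] at h3
    rw [h3]
    exact mul_lt_mul_of_pos_left h1 hfact
  have hgx : (d.factorial : ℝ) * (g (symRankOne x)).re = (f x).re := by
    have : f x = ((d.factorial : ℝ) : ℂ) * g (symRankOne x) := by
      rw [hf, symRankOne, ← Complex.coe_smul, map_smul, map_sum, smul_eq_mul, ← mul_assoc,
        ← Complex.ofReal_mul, mul_inv_cancel₀ hfact.ne', Complex.ofReal_one, one_mul]
    rw [this, Complex.re_ofReal_mul]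
  have h1 : (d.factorial : ℝ) * u < d.factorial * (g (symRankOne x)).re :=
    mul_lt_mul_of_pos_left hux hfact
  linarith [Complex.re_le_norm (f x), hy x hx]

open Pointwise in
theorem symRankOne_mem_smul_convexHull {d n : ℕ} (hd : 0 < d)
    (x : Fin d → EuclideanSpace ℂ (Fin n)) :
    symRankOne x ∈ (∏ k, ‖x k‖) • convexHull ℝ (powerBall d n) := by
  have hunit : ‖fun k => ((‖x k‖ : ℂ)⁻¹) • x k‖ ≤ 1 := by
    rw [pi_norm_le_iff_of_nonneg zero_le_one]
    intro k
    rw [norm_smul, norm_inv, Complex.norm_real, norm_norm]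
    exact inv_mul_le_one
  refine ⟨_, symRankOne_mem_convexHull_of_norm_le_one hd _ hunit, ?_⟩
  have hx : x = fun k => (‖x k‖ : ℂ) • ((‖x k‖ : ℂ)⁻¹) • x k := by
    funext k
    rcases eq_or_ne (x k) 0 with h | h
    · simp [h]
    · rw [smul_inv_smul₀ (by simpa using h)]
  conv_rhs => rw [hx]
  simp only [symRankOne, Function.comp_def]
  rw [smul_comm, Finset.smul_sum]
  congr 1
  refine Finset.sum_congr rfl fun σ _ => ?_
  rw [rankOne_smul (fun k => (‖x (σ k)‖ : ℂ)) fun k => ((‖x (σ k)‖ : ℂ)⁻¹) • x (σ k),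
    Equiv.prod_comp σ fun k => (‖x k‖ : ℂ), ← Complex.ofReal_prod, Complex.coe_smul]

theorem eq_sum_symRankOne {d n r : ℕ} {A : (Fin d → Fin n) → ℂ}
    (hsymm : ∀ (σ : Equiv.Perm (Fin d)) (i : Fin d → Fin n), A (i ∘ σ) = A i)
    (x : Fin r → Fin d → EuclideanSpace ℂ (Fin n)) (hA : A = ∑ j, rankOne (x j)) :
    A = ∑ j, symRankOne (x j) := by
  have hσ : ∀ σ : Equiv.Perm (Fin d), ∑ j, rankOne (x j ∘ σ) = A := by
    intro σ
    ext i
    rw [← hsymm σ⁻¹ i, hA, Finset.sum_apply, Finset.sum_apply]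
    refine Finset.sum_congr rfl fun j _ => ?_
    rw [← rankOne_comp_perm (x j) σ]
    congr 1
    ext k
    simp
  have hfact : (d.factorial : ℝ) ≠ 0 := by exact_mod_cast d.factorial_ne_zero
  simp only [symRankOne]
  rw [← Finset.smul_sum, Finset.sum_comm]
  simp only [hσ, Finset.sum_const, Finset.card_univ, Fintype.card_perm, Fintype.card_fin]
  rw [← Nat.cast_smul_eq_nsmul ℝ, inv_smul_smul₀ hfact]

theorem exists_eq_sum_rankOne {d n : ℕ} (hd : 0 < d) (A : (Fin d → Fin n) → ℂ) :
    ∃ (r : ℕ) (x : Fin r → Fin d → EuclideanSpace ℂ (Fin n)), A = ∑ j, rankOne (x j) := by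
  let e := Fintype.equivFin (Fin d → Fin n)
  let X (i : Fin d → Fin n) (k : Fin d) : EuclideanSpace ℂ (Fin n) :=
    (if k = ⟨0, hd⟩ then A i else 1) • EuclideanSpace.single (i k) (1 : ℂ)
  refine ⟨_, X ∘ e.symm, ?_⟩
  have : ∀ i, rankOne (X i) = Pi.single i (A i) := by
    intro i
    rw [rankOne_smul (fun k => if k = ⟨0, hd⟩ then A i else 1)
      fun k => EuclideanSpace.single (i k) (1 : ℂ)]
    ext j
    rcases eq_or_ne j i with rfl | hji
    · simp [rankOne]
    · obtain ⟨k, hk⟩ := Function.ne_iff.1 hji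
      simp only [Pi.smul_apply, rankOne, Pi.single_eq_of_ne hji]
      rw [Finset.prod_eq_zero (f := fun l => EuclideanSpace.single (i l) (1 : ℂ) (j l))
        (Finset.mem_univ k) (by simp [hk]), smul_zero]
  simp only [Function.comp_apply]
  rw [e.symm.sum_comp fun i => rankOne (X i)]
  simp only [this]
  exact (Finset.univ_sum_single A).symm

/-- The decomposition lengths defining the nuclear norm are bounded below. -/
theorem bddBelow_nucNorm {ι : Type} [Fintype ι] [DecidableEq ι] {n : ι → ℕ}
    (A : ((k : ι) → Fin (n k)) → ℂ) :
    BddBelow { s : ℝ | ∃ (r : ℕ) (x : Fin r → (k : ι) → EuclideanSpace ℂ (Fin (n k))),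
      A = (∑ i, rankOne (x i)) ∧ s = ∑ i, ∏ k, ‖x i k‖ } := by
  refine ⟨0, ?_⟩
  rintro s ⟨r, x, -, rfl⟩
  positivity

open Pointwise Filter Topology in
/-- A symmetric tensor lies in the ball of radius its nuclear norm of the gauge whose unit ball is
the convex hull of the `d`-th tensor powers of unit vectors. -/
theorem mem_nucNorm_smul_convexHull {d n : ℕ} (hd : 0 < d) (A : (Fin d → Fin n) → ℂ)
    (hsymm : ∀ (σ : Equiv.Perm (Fin d)) (i : Fin d → Fin n), A (i ∘ σ) = A i) :
    A ∈ nucNorm A • convexHull ℝ (powerBall d n) := by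
  have hK := isCompact_convexHull_powerBall d n
  obtain ⟨r, x, hA⟩ := exists_eq_sum_rankOne hd A
  obtain ⟨s, -, hs, hmem⟩ := exists_seq_tendsto_sInf (S := { s : ℝ | ∃ (r : ℕ)
    (x : Fin r → Fin d → EuclideanSpace ℂ (Fin n)),
    A = (∑ i, rankOne (x i)) ∧ s = ∑ i, ∏ k, ‖x i k‖ }) ⟨_, r, x, hA, rfl⟩ (bddBelow_nucNorm A)
  have hsK : ∀ m, ∃ k ∈ convexHull ℝ (powerBall d n), s m • k = A := by
    intro m
    obtain ⟨r, x, hA, hsm⟩ := hmem m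
    change A ∈ s m • convexHull ℝ (powerBall d n)
    rw [hsm, eq_sum_symRankOne hsymm x hA]
    exact (convex_convexHull ℝ _).sum_mem_sum_smul ⟨0, zero_mem_convexHull_powerBall hd⟩ _
      (fun _ _ => by positivity) fun _ _ => symRankOne_mem_smul_convexHull hd _
  choose k hkK hk using hsK
  obtain ⟨k₀, hk₀, φ, hφ, hlim⟩ := hK.tendsto_subseq hkK
  refine ⟨k₀, hk₀, tendsto_nhds_unique ((hs.comp hφ.tendsto_atTop).smul hlim) ?_⟩
  simp [hk]

/-- Corollary 5.2: for a symmetric complex `d`-tensor `A`, the nuclear norm equals the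
minimum of `Σ ‖x_j‖^d` over all symmetric rank-one decompositions `A = Σ x_j^{⊗d}`,
and the minimum is attained. -/
theorem stmt10 {d n : ℕ} (hd : 0 < d) (A : (Fin d → Fin n) → ℂ)
    (hsymm : ∀ (σ : Equiv.Perm (Fin d)) (i : Fin d → Fin n), A (i ∘ σ) = A i) :
    IsLeast { s : ℝ | ∃ (r : ℕ) (x : Fin r → EuclideanSpace ℂ (Fin n)),
      A = (∑ j, rankOne (fun _ : Fin d => x j)) ∧
      s = ∑ j, ‖x j‖ ^ d } (nucNorm A) := by
  have hlower : nucNorm A ∈ lowerBounds { s : ℝ | ∃ (r : ℕ)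
      (x : Fin r → EuclideanSpace ℂ (Fin n)),
      A = (∑ j, rankOne (fun _ : Fin d => x j)) ∧ s = ∑ j, ‖x j‖ ^ d } := by
    rintro s ⟨r, x, hA, rfl⟩
    exact csInf_le (bddBelow_nucNorm A) ⟨r, fun j _ => x j, hA, by simp⟩
  refine ⟨?_, hlower⟩
  have hN : 0 ≤ nucNorm A := Real.sInf_nonneg (by rintro s ⟨r, x, -, rfl⟩; positivity)
  obtain ⟨k, hk, hkA⟩ := mem_nucNorm_smul_convexHull hd A hsymm
  obtain ⟨ι, _, w, z, hw, hw1, hz, rfl⟩ := mem_convexHull_iff_exists_fintype.1 hk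
  choose y hy1 hy using hz
  let e := Fintype.equivFin ι
  let c (i : ι) : ℝ := (nucNorm A * w i) ^ (d : ℝ)⁻¹
  have hc : ∀ i, c i ^ d = nucNorm A * w i := fun i =>
    Real.rpow_inv_natCast_pow (mul_nonneg hN (hw i)) hd.ne'
  have hc0 : ∀ i, 0 ≤ c i := fun i => Real.rpow_nonneg (mul_nonneg hN (hw i)) _
  have hdec : A = ∑ j, rankOne (fun _ : Fin d => (c (e.symm j) : ℂ) • y (e.symm j)) := by
    rw [e.symm.sum_comp fun i => rankOne (fun _ : Fin d => (c i : ℂ) • y i)]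
    conv_lhs => rw [← hkA]
    simp only [Finset.smul_sum]
    refine Finset.sum_congr rfl fun i _ => ?_
    rw [rankOne_smul (fun _ => (c i : ℂ)) fun _ => y i, Finset.prod_const, Finset.card_univ,
      Fintype.card_fin, ← Complex.ofReal_pow, hc, Complex.coe_smul, mul_smul, ← hy i]
  refine ⟨_, _, hdec, le_antisymm (hlower ⟨_, _, hdec, rfl⟩) ?_⟩
  rw [e.symm.sum_comp fun i => ‖(c i : ℂ) • y i‖ ^ d]
  calc ∑ i, ‖(c i : ℂ) • y i‖ ^ d ≤ ∑ i, nucNorm A * w i := by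
        refine Finset.sum_le_sum fun i _ => ?_
        rw [norm_smul, mul_pow, Complex.norm_real, Real.norm_of_nonneg (hc0 i), hc]
        exact mul_le_of_le_one_right (mul_nonneg hN (hw i))
          (pow_le_one₀ (norm_nonneg _) (mem_closedBall_zero_iff.1 (hy1 i)))
    _ = nucNorm A := by rw [← Finset.mul_sum, hw1, mul_one]
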